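/- arXiv:1906.04893 — 3 statements merged into one kernel-verified Lean document; each statement's English description precedes it below -/
import Mathlib

section
/- (Appendix Lemma, repeated nonlinearities with φ(0)=0.) Let 0 ≤ α < β be real numbers and let φ : ℝ → ℝ be slope-restricted on [α, β] with φ(0) = 0. Let n ≥ 1, let λ : Fin n × Fin n → ℝ with λᵢⱼ ≥ 0 for all i, j, and let T = Σᵢ λᵢᵢ eᵢ eᵢᵀ + Σ_{i<j} λᵢⱼ (eᵢ − eⱼ)(eᵢ − eⱼ)ᵀ ∈ ℝ^{n×n}. Define Φ : ℝⁿ → ℝⁿ by Φ(x)ᵢ = φ(xᵢ). Then for every x ∈ ℝⁿ, the vector v = (x, Φ(x)) ∈ ℝ^{2n} satisfies vᵀ Q v ≥ 0, where Q = [[−2αβ T, (α+β) T], [(α+β) T, −2 T]]. -/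
open Matrix

/-- The matrix `[[−2αβT, (α+β)T], [(α+β)T, −2T]]` of the sector constraint with multiplier `T`. -/
def sectorMatrix {ι : Type*} (α β : ℝ) (T : Matrix ι ι ℝ) : Matrix (ι ⊕ ι) (ι ⊕ ι) ℝ :=
  Matrix.fromBlocks ((-2 * α * β) • T) ((α + β) • T) ((α + β) • T) ((-2 : ℝ) • T)

section SectorMatrix

variable {ι : Type*} [Fintype ι] (α β : ℝ) (x y : ι → ℝ)

/-- The quadratic form of the sector constraint as a linear functional of the multiplier. -/
def sectorForm : Matrix ι ι ℝ →ₗ[ℝ] ℝ where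
  toFun T := Sum.elim x y ⬝ᵥ sectorMatrix α β T *ᵥ Sum.elim x y
  map_add' S T := by
    have h : sectorMatrix α β (S + T) = sectorMatrix α β S + sectorMatrix α β T := by
      simp only [sectorMatrix, fromBlocks_add, smul_add]
    rw [h, add_mulVec, dotProduct_add]
  map_smul' c T := by
    have h : sectorMatrix α β (c • T) = c • sectorMatrix α β T := by
      simp only [sectorMatrix, fromBlocks_smul, smul_comm c]
    rw [h, smul_mulVec, dotProduct_smul, RingHom.id_apply]

theorem sectorForm_vecMulVec (w : ι → ℝ) :
    sectorForm α β x y (vecMulVec w w) =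
      2 * ((w ⬝ᵥ y - α * (w ⬝ᵥ x)) * (β * (w ⬝ᵥ x) - w ⬝ᵥ y)) := by
  simp only [sectorForm, sectorMatrix, LinearMap.coe_mk, AddHom.coe_mk, fromBlocks_mulVec,
    sumElim_dotProduct_sumElim, Sum.elim_comp_inl, Sum.elim_comp_inr, smul_mulVec,
    vecMulVec_mulVec, dotProduct_add, dotProduct_smul, smul_eq_mul, op_smul_eq_smul,
    dotProduct_comm x w, dotProduct_comm y w]
  ring

end SectorMatrix

/-- Slope restriction in the form of an incremental sector inequality. -/
theorem sector_mul_nonneg_of_slope_restricted {α β : ℝ} {φ : ℝ → ℝ}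
    (hφ : ∀ x y : ℝ, α * (y - x) ^ 2 ≤ (φ y - φ x) * (y - x) ∧
        (φ y - φ x) * (y - x) ≤ β * (y - x) ^ 2) (s t : ℝ) :
    0 ≤ ((φ t - φ s) - α * (t - s)) * (β * (t - s) - (φ t - φ s)) := by
  rcases eq_or_ne t s with rfl | hne
  · simp
  · obtain ⟨hl, hu⟩ := hφ s t
    have hpos : 0 < (t - s) ^ 2 := sq_pos_iff.mpr (sub_ne_zero.mpr hne)
    refine nonneg_of_mul_nonneg_right ?_ hpos
    calc 0 ≤ ((φ t - φ s) * (t - s) - α * (t - s) ^ 2) *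
          (β * (t - s) ^ 2 - (φ t - φ s) * (t - s)) :=
          mul_nonneg (sub_nonneg.mpr hl) (sub_nonneg.mpr hu)
      _ = _ := by ring

/-- Appendix Lemma, repeated nonlinearities with `φ(0) = 0`: if `φ` is
slope-restricted on `[α, β]` with `0 ≤ α < β` and `φ(0) = 0`, `λᵢⱼ ≥ 0`, and
`T = Σᵢ λᵢᵢ eᵢeᵢᵀ + Σ_{i<j} λᵢⱼ (eᵢ−eⱼ)(eᵢ−eⱼ)ᵀ`, then for every `x ∈ ℝⁿ` the vector
`v = (x, Φ(x))` satisfies `vᵀ Q v ≥ 0` with `Q = [[−2αβT, (α+β)T], [(α+β)T, −2T]]`. -/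
theorem repeated_nonlinearity_quadratic_constraint_at_zero
    {n : ℕ} (hn : 1 ≤ n) (α β : ℝ) (hα : 0 ≤ α) (hαβ : α < β) (φ : ℝ → ℝ)
    (hφ : ∀ x y : ℝ, α * (y - x) ^ 2 ≤ (φ y - φ x) * (y - x) ∧
        (φ y - φ x) * (y - x) ≤ β * (y - x) ^ 2)
    (hφ0 : φ 0 = 0)
    (lam : Fin n × Fin n → ℝ) (hlam : ∀ p, 0 ≤ lam p)
    (T : Matrix (Fin n) (Fin n) ℝ)
    (hT : T = (∑ i : Fin n,
          lam (i, i) • vecMulVec (Pi.single i 1 : Fin n → ℝ) (Pi.single i 1 : Fin n → ℝ)) +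
        ∑ p ∈ Finset.univ.filter (fun p : Fin n × Fin n => p.1 < p.2),
          lam p • vecMulVec ((Pi.single p.1 1 : Fin n → ℝ) - (Pi.single p.2 1 : Fin n → ℝ))
            ((Pi.single p.1 1 : Fin n → ℝ) - (Pi.single p.2 1 : Fin n → ℝ)))
    (x : Fin n → ℝ) :
    0 ≤ Sum.elim x (fun i => φ (x i)) ⬝ᵥ
        (Matrix.fromBlocks ((-2 * α * β) • T) ((α + β) • T) ((α + β) • T) ((-2 : ℝ) • T)) *ᵥ
        Sum.elim x (fun i => φ (x i)) := by
  change 0 ≤ sectorForm α β x (fun i => φ (x i)) T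
  rw [hT, map_add, map_sum, map_sum]
  refine add_nonneg (Finset.sum_nonneg fun i _ => ?_) (Finset.sum_nonneg fun p _ => ?_)
  · rw [map_smul, sectorForm_vecMulVec]
    refine mul_nonneg (hlam _) (mul_nonneg zero_le_two ?_)
    simpa [hφ0] using sector_mul_nonneg_of_slope_restricted hφ 0 (x i)
  · rw [map_smul, sectorForm_vecMulVec]
    refine mul_nonneg (hlam _) (mul_nonneg zero_le_two ?_)
    simpa [sub_dotProduct] using sector_mul_nonneg_of_slope_restricted hφ (x p.2) (x p.1)
end

section
/- (Proposition 1: robustness certification via Lipschitz bounds.) Let f : ℝⁿ → ℝᵏ satisfy ‖f(x) − f(y)‖₂ ≤ L₂ ‖x − y‖₂ for all x, y ∈ ℝⁿ, where ‖·‖₂ is the Euclidean norm. Let x★ ∈ ℝⁿ, let i★ ∈ {1,…,k} be such that f_{i★}(x★) > f_j(x★) for all j ≠ i★, and let ε > 0. If L₂ ≤ (1/(ε√2)) · min_{j ≠ i★} |f_j(x★) − f_{i★}(x★)|, then for every x ∈ ℝⁿ with ‖x − x★‖₂ ≤ ε, one has f_{i★}(x) ≥ f_j(x) for all j ≠ i★;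 i.e., the classification argmax_i f_i(x) remains i★ on the entire ε-ball around x★. -/
/-- Two distinct coordinates of a Euclidean vector differ by at most `√2` times its norm. -/
theorem EuclideanSpace.sub_apply_le_sqrt_two_mul_norm {ι : Type*} [Fintype ι]
    (v : EuclideanSpace ℝ ι) {i j : ι} (hij : i ≠ j) : v i - v j ≤ √2 * ‖v‖ := by
  classical
  have hsum : v i ^ 2 + v j ^ 2 ≤ ‖v‖ ^ 2 := by
    rw [EuclideanSpace.real_norm_sq_eq, ← Finset.sum_pair (f := fun l => v l ^ 2) hij]
    exact Finset.sum_le_sum_of_subset_of_nonneg (Finset.subset_univ _)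
      fun _ _ _ => sq_nonneg _
  refine le_of_abs_le (abs_le_of_sq_le_sq ?_ (by positivity))
  rw [mul_pow, Real.sq_sqrt zero_le_two]
  nlinarith [sq_nonneg (v i + v j)]


/-- Proposition 1: robustness certification via Lipschitz bounds:
if `f` is `L₂`-Lipschitz in the Euclidean norm, `i★` is the strict argmax of `f(x★)`,
`ε > 0`, and `L₂ ≤ (1/(ε√2)) · |f_j(x★) − f_{i★}(x★)|` for every `j ≠ i★` (i.e. `L₂` is
at most `(1/(ε√2))` times the minimum gap), then every `x` with `‖x − x★‖₂ ≤ ε`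
satisfies `f_{i★}(x) ≥ f_j(x)` for all `j ≠ i★`. -/
theorem robustness_certification_via_lipschitz
    {n k : ℕ} (f : EuclideanSpace ℝ (Fin n) → EuclideanSpace ℝ (Fin k)) (L2 : ℝ)
    (hf : ∀ x y : EuclideanSpace ℝ (Fin n), ‖f x - f y‖ ≤ L2 * ‖x - y‖)
    (xstar : EuclideanSpace ℝ (Fin n)) (istar : Fin k)
    (hmax : ∀ j : Fin k, j ≠ istar → f xstar j < f xstar istar)
    (ε : ℝ) (hε : 0 < ε)
    (hL : ∀ j : Fin k, j ≠ istar →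
      L2 ≤ 1 / (ε * Real.sqrt 2) * |f xstar j - f xstar istar|) :
    ∀ x : EuclideanSpace ℝ (Fin n), ‖x - xstar‖ ≤ ε →
      ∀ j : Fin k, j ≠ istar → f x j ≤ f x istar := by
  intro x hx j hj
  have hcoord : (f x - f xstar) j - (f x - f xstar) istar ≤ √2 * ‖f x - f xstar‖ :=
    EuclideanSpace.sub_apply_le_sqrt_two_mul_norm _ hj
  have hbound : √2 * ‖f x - f xstar‖ ≤ |f xstar j - f xstar istar| := calc
    √2 * ‖f x - f xstar‖
      ≤ √2 * (1 / (ε * √2) * |f xstar j - f xstar istar| * ε) := by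
        gcongr
        refine (hf x xstar).trans ?_
        gcongr
        exact hL j hj
    _ = |f xstar j - f xstar istar| := by field_simp
  rw [abs_of_neg (sub_neg.mpr (hmax j hj))] at hbound
  simp only [PiLp.sub_apply] at hcoord
  linarith
end

section
/- Let k ≥ 2, fix i ∈ {1,…,k}, and let P_i = {y ∈ ℝᵏ : y_j ≤ y_i for all j} be the polytope of score vectors classified as class i. Let y★ ∈ ℝᵏ satisfy y★_i > y★_j for all j ≠ i. Then the Euclidean distance from y★ to the topological boundary ∂P_i of P_i equals (1/√2) · min_{j ≠ i} (y★_i − y★_j); i.e., inf_{y ∈ ∂P_i} ‖y − y★‖₂ = (1/√2) · min_{j ≠ i} |y★_j − y★_i|. -/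
theorem frontier_setOf_forall_le_apply {ι : Type*} [Fintype ι] [DecidableEq ι] (i : ι) :
    frontier {y : EuclideanSpace ℝ ι | ∀ j, y j ≤ y i} =
      {y | (∀ j, y j ≤ y i) ∧ ∃ j ≠ i, y j = y i} := by
  have hclosed : IsClosed {y : EuclideanSpace ℝ ι | ∀ j, y j ≤ y i} := by
    simp only [Set.ofPred_forall]
    exact isClosed_iInter fun j => isClosed_le (by fun_prop) (by fun_prop)
  rw [hclosed.frontier_eq]
  ext y
  refine and_congr_right fun hy => ⟨fun hint => ?_, ?_⟩
  · by_contra! h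
    have hopen : IsOpen {y : EuclideanSpace ℝ ι | ∀ j, j ≠ i → y j < y i} := by
      simp only [Set.ofPred_forall]
      exact isOpen_iInter_of_finite fun j => isOpen_iInter_of_finite fun _ =>
        isOpen_lt (by fun_prop) (by fun_prop)
    refine hint (interior_maximal (fun z hz j => ?_) hopen
      (fun j hj => lt_of_le_of_ne (hy j) (h j hj)))
    by_cases hj : j = i
    · rw [hj]
    · exact (hz j hj).le
  · rintro ⟨j, hj, hji⟩ hint
    have hcont : Continuous fun t : ℝ => y + t • EuclideanSpace.single j (1 : ℝ) := by fun_prop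
    have hnhds := hcont.continuousAt.preimage_mem_nhds (x := 0)
      (by simpa using mem_interior_iff_mem_nhds.mp hint)
    obtain ⟨ε, hε, hball⟩ := Metric.mem_nhds_iff.mp hnhds
    have hmem : ε / 2 ∈ Metric.ball (0 : ℝ) ε := by
      rw [Metric.mem_ball, Real.dist_0_eq_abs, abs_of_pos (by positivity)]
      linarith
    have hle := hball hmem j
    simp [hj.symm, hji] at hle
    linarith

theorem abs_apply_sub_apply_le_sqrt_two_mul_norm {ι : Type*} [Fintype ι] [DecidableEq ι]
    (v : EuclideanSpace ℝ ι) {i j : ι} (hij : j ≠ i) : |v j - v i| ≤ √2 * ‖v‖ := by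
  have hsum : v j ^ 2 + v i ^ 2 ≤ ‖v‖ ^ 2 := by
    rw [EuclideanSpace.real_norm_sq_eq, ← Finset.sum_pair (f := fun l => v l ^ 2) hij]
    exact Finset.sum_le_sum_of_subset_of_nonneg (Finset.subset_univ _) fun _ _ _ => sq_nonneg _
  refine abs_le_of_sq_le_sq ?_ (by positivity)
  rw [mul_pow, Real.sq_sqrt zero_le_two]
  nlinarith [sq_nonneg (v j + v i)]

theorem norm_single_sub_single {ι : Type*} [Fintype ι] [DecidableEq ι]
    {i j : ι} (hij : j ≠ i) (a : ℝ) :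
    ‖EuclideanSpace.single j a - EuclideanSpace.single i a‖ = √2 * |a| := by
  rw [← sq_eq_sq₀ (norm_nonneg _) (by positivity), norm_sub_sq_real, mul_pow,
    Real.sq_sqrt zero_le_two]
  simp [EuclideanSpace.inner_single_left, hij]
  ring


/-- for `k ≥ 2` and `y★` with `y★ᵢ > y★ⱼ` for all `j ≠ i`, the Euclidean
distance from `y★` to the topological boundary of the polytope
`Pᵢ = {y ∈ ℝᵏ : yⱼ ≤ yᵢ ∀j}` equals `(1/√2) · min_{j ≠ i} |y★ⱼ − y★ᵢ|`. -/
theorem dist_to_decision_boundary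
    {k : ℕ} (hk : 2 ≤ k) (i : Fin k) (ystar : EuclideanSpace ℝ (Fin k))
    (hystar : ∀ j : Fin k, j ≠ i → ystar j < ystar i)
    (hne : (Finset.univ.erase i).Nonempty) :
    Metric.infDist ystar
        (frontier {y : EuclideanSpace ℝ (Fin k) | ∀ j : Fin k, y j ≤ y i}) =
      1 / Real.sqrt 2 * (Finset.univ.erase i).inf' hne (fun j => |ystar j - ystar i|) := by

  rw [frontier_setOf_forall_le_apply]
  have hsqrt : 0 < √(2 : ℝ) := by positivity
  obtain ⟨j, hj, hmin⟩ := Finset.exists_mem_eq_inf' hne fun j => |ystar j - ystar i|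
  have hji : j ≠ i := Finset.ne_of_mem_erase hj
  have habs : ∀ l, l ≠ i → |ystar l - ystar i| = ystar i - ystar l := fun l hl => by
    rw [abs_sub_comm, abs_of_pos (sub_pos.mpr (hystar l hl))]
  set a := (ystar i - ystar j) / 2 with ha
  have hapos : 0 < a := half_pos (sub_pos.mpr (hystar j hji))
  set w := EuclideanSpace.single j a - EuclideanSpace.single i a with hw
  have hmem : ystar + w ∈ {y : EuclideanSpace ℝ (Fin k) |
      (∀ j, y j ≤ y i) ∧ ∃ j ≠ i, y j = y i} := by
    have hwi : w i = -a := by simp [hw, hji.symm]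
    have hwj : w j = a := by simp [hw, hji]
    refine ⟨fun l => ?_, j, hji, ?_⟩
    · rcases eq_or_ne l i with rfl | hl
      · rfl
      have hle := hmin ▸ Finset.inf'_le (fun j => |ystar j - ystar i|)
        (Finset.mem_erase.mpr ⟨hl, Finset.mem_univ l⟩)
      simp only [habs j hji, habs l hl] at hle
      rcases eq_or_ne l j with rfl | hlj
      · simp only [PiLp.add_apply, hwi, hwj]
        linarith
      · have hwl : w l = 0 := by simp [hw, hl, hlj]
        simp only [PiLp.add_apply, hwi, hwl]
        linarith
    · simp only [PiLp.add_apply, hwi, hwj]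
      linarith
  apply le_antisymm
  · refine (Metric.infDist_le_dist_of_mem hmem).trans_eq ?_
    rw [dist_self_add_right, norm_single_sub_single hji, abs_of_pos hapos, hmin, habs j hji]
    field_simp
    rw [Real.sq_sqrt zero_le_two]
    linarith
  · refine (Metric.le_infDist ⟨_, hmem⟩).mpr ?_
    rintro y ⟨-, l, hl, hyl⟩
    rw [one_div_mul_eq_div, div_le_iff₀' hsqrt, dist_eq_norm]
    refine (Finset.inf'_le _ (Finset.mem_erase.mpr ⟨hl, Finset.mem_univ l⟩)).trans ?_
    simpa [hyl] using abs_apply_sub_apply_le_sqrt_two_mul_norm (ystar - y) hl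
end
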